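/- Let α, β, γ > 0 be real. Then for every real t, the derivative of the Prabhakar function satisfies (d/dt) E_{α,β}^γ(t) = γ E_{α, α+β}^{γ+1}(t). -/

import Mathlib

open scoped BigOperators

/-- Pochhammer symbol `(γ)_k = Γ(γ+k)/Γ(γ)`. -/
noncomputable def poch (γ : ℝ) (k : ℕ) : ℝ := Real.Gamma (γ + k) / Real.Gamma γ

/-- The Prabhakar (three-parameter Mittag-Leffler) function
`E_{α,β}^γ(x) = ∑_{k≥0} (γ)_k x^k / (k! Γ(αk+β))`. -/
noncomputable def prabhakar (α β γ x : ℝ) : ℝ :=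
  ∑' k : ℕ, poch γ k * x ^ k / (k.factorial * Real.Gamma (α * k + β))

open Filter Topology

/-- By log-convexity, `Γ(x + a) / Γ(x)` is at least `(x - 1) ^ a`. -/
lemma rpow_mul_Gamma_le_Gamma_add {a x : ℝ} (ha : 0 < a) (hx : 1 < x) :
    (x - 1) ^ a * Real.Gamma x ≤ Real.Gamma (x + a) := by
  have h0 : 0 < x - 1 := by linarith
  have hG0 : 0 < Real.Gamma (x - 1) := Real.Gamma_pos_of_pos h0
  have hG : 0 < Real.Gamma x := Real.Gamma_pos_of_pos (by linarith)
  have hGa : 0 < Real.Gamma (x + a) := Real.Gamma_pos_of_pos (by linarith)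
  have hs := Real.convexOn_log_Gamma.slope_mono_adjacent (x := x - 1) (y := x) (z := x + a)
    h0 (Set.mem_Ioi.2 (by linarith)) (by linarith) (by linarith)
  have hrec : Real.Gamma x = (x - 1) * Real.Gamma (x - 1) := by
    simpa using Real.Gamma_add_one h0.ne'
  have hlog : Real.log (Real.Gamma x) = Real.log (x - 1) + Real.log (Real.Gamma (x - 1)) := by
    rw [hrec, Real.log_mul h0.ne' hG0.ne']
  simp only [Function.comp_apply, sub_sub_cancel, div_one, add_sub_cancel_left] at hs
  rw [le_div_iff₀ ha] at hs
  rw [← Real.log_le_log_iff (by positivity) hGa, Real.log_mul (by positivity) hG.ne',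
    Real.log_rpow h0]
  rw [hlog] at hs ⊢
  linarith

lemma tendsto_Gamma_div_Gamma_add_atTop {a : ℝ} (ha : 0 < a) :
    Tendsto (fun x : ℝ => Real.Gamma x / Real.Gamma (x + a)) atTop (𝓝 0) := by
  have hlim : Tendsto (fun x : ℝ => ((x - 1) ^ a)⁻¹) atTop (𝓝 0) :=
    ((tendsto_rpow_atTop ha).comp
      (tendsto_atTop_add_const_right atTop (-1 : ℝ) tendsto_id)).inv_tendsto_atTop
  refine squeeze_zero' ?_ ?_ hlim
  · filter_upwards [eventually_gt_atTop 1] with x hx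
    exact div_nonneg (Real.Gamma_pos_of_pos (by linarith)).le
      (Real.Gamma_pos_of_pos (by linarith)).le
  · filter_upwards [eventually_gt_atTop 1] with x hx
    have h0 : 0 < x - 1 := by linarith
    rw [div_le_iff₀ (Real.Gamma_pos_of_pos (by linarith)), inv_mul_eq_div,
      le_div_iff₀ (by positivity), mul_comm]
    exact rpow_mul_Gamma_le_Gamma_add ha hx

lemma poch_pos {γ : ℝ} (hγ : 0 < γ) (k : ℕ) : 0 < poch γ k :=
  div_pos (Real.Gamma_pos_of_pos (by positivity)) (Real.Gamma_pos_of_pos hγ)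

lemma poch_succ {γ : ℝ} (hγ : 0 < γ) (k : ℕ) : poch γ (k + 1) = (γ + k) * poch γ k := by
  have h : γ + (k : ℝ) ≠ 0 := by positivity
  rw [poch, poch, Nat.cast_succ, ← add_assoc, Real.Gamma_add_one h, mul_div_assoc]

lemma poch_succ_left {γ : ℝ} (hγ : 0 < γ) (k : ℕ) : poch γ (k + 1) = γ * poch (γ + 1) k := by
  have h := (Real.Gamma_pos_of_pos hγ).ne'
  rw [poch, poch, Nat.cast_succ, Real.Gamma_add_one hγ.ne', add_right_comm γ 1 (k : ℝ), ← add_assoc]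
  field_simp

/-- The Prabhakar series converges on the positive half-line. -/
lemma summable_prabhakar {α β γ x : ℝ} (hα : 0 < α) (hβ : 0 < β) (hγ : 0 < γ) (hx : 0 < x) :
    Summable fun k : ℕ => poch γ k * x ^ k / (k.factorial * Real.Gamma (α * k + β)) := by
  have hG (k : ℕ) : 0 < Real.Gamma (α * k + β) := Real.Gamma_pos_of_pos (by positivity)
  have hpos (k : ℕ) : 0 < poch γ k * x ^ k / (k.factorial * Real.Gamma (α * k + β)) := by
    have := hG k
    have := poch_pos hγ k
    positivity
  refine summable_of_ratio_test_tendsto_lt_one zero_lt_one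
    (Eventually.of_forall fun k => (hpos k).ne') ?_
  have hΓ : Tendsto (fun k : ℕ => Real.Gamma (α * k + β) / Real.Gamma (α * k + β + α))
      atTop (𝓝 0) :=
    (tendsto_Gamma_div_Gamma_add_atTop hα).comp
      (tendsto_atTop_add_const_right _ _ (tendsto_natCast_atTop_atTop.const_mul_atTop hα))
  have hinv : Tendsto (fun k : ℕ => 1 + (γ - 1) * (1 / ((k : ℝ) + 1))) atTop
      (𝓝 (1 + (γ - 1) * 0)) :=
    (tendsto_one_div_add_atTop_nhds_zero_nat.const_mul _).const_add _
  have hlim := (hinv.mul_const x).mul hΓ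
  rw [mul_zero] at hlim
  refine hlim.congr fun k => ?_
  rw [Real.norm_of_nonneg (hpos _).le, Real.norm_of_nonneg (hpos _).le, poch_succ hγ,
    Nat.factorial_succ, Nat.cast_mul, Nat.cast_succ, mul_add_one, add_right_comm (α * (k : ℝ)) α β]
  have h1 := (hG k).ne'
  have h2 : Real.Gamma (α * k + β + α) ≠ 0 := (Real.Gamma_pos_of_pos (by positivity)).ne'
  have h3 := (poch_pos hγ k).ne'
  have h4 : (k.factorial : ℝ) ≠ 0 := by positivity
  have h5 : (k : ℝ) + 1 ≠ 0 := by positivity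
  field_simp
  ring

/-- The coefficients of the termwise derivative of the Prabhakar series. -/
lemma succ_mul_poch_div {γ : ℝ} (hγ : 0 < γ) (α β y : ℝ) (k : ℕ) :
    poch γ (k + 1) * (((k + 1 : ℕ) : ℝ) * y ^ k) /
        ((k + 1).factorial * Real.Gamma (α * ((k + 1 : ℕ) : ℝ) + β)) =
      γ * (poch (γ + 1) k * y ^ k / (k.factorial * Real.Gamma (α * k + (α + β)))) := by
  have h : ((k + 1 : ℕ) : ℝ) ≠ 0 := by positivity
  rw [poch_succ_left hγ, Nat.factorial_succ, Nat.cast_mul,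
    show α * ((k + 1 : ℕ) : ℝ) + β = α * k + (α + β) by push_cast; ring,
    show γ * poch (γ + 1) k * (((k + 1 : ℕ) : ℝ) * y ^ k) =
      ((k + 1 : ℕ) : ℝ) * (γ * poch (γ + 1) k * y ^ k) by ring,
    mul_assoc ((k + 1 : ℕ) : ℝ), mul_div_mul_left _ _ h]
  ring

theorem hasDerivAt_prabhakar {α β γ : ℝ} (hα : 0 < α) (hβ : 0 < β) (hγ : 0 < γ) (t : ℝ) :
    HasDerivAt (fun x => prabhakar α β γ x) (γ * prabhakar α (α + β) (γ + 1) t) t := by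
  let g' (k : ℕ) (y : ℝ) : ℝ :=
    poch γ k * ((k : ℝ) * y ^ (k - 1)) / (k.factorial * Real.Gamma (α * k + β))
  have hg' (k : ℕ) (y : ℝ) : g' (k + 1) y =
      γ * (poch (γ + 1) k * y ^ k / (k.factorial * Real.Gamma (α * k + (α + β)))) :=
    succ_mul_poch_div hγ α β y k
  have hR : 0 < |t| + 1 := by positivity
  have hsum : Summable fun k => g' k (|t| + 1) := by
    rw [← summable_nat_add_iff 1]
    simp only [hg']
    exact (summable_prabhakar hα (by positivity) (by positivity) hR).mul_left γ
  have hbound (k : ℕ) (y : ℝ) (hy : y ∈ Metric.ball (0 : ℝ) (|t| + 1)) :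
      ‖g' k y‖ ≤ g' k (|t| + 1) := by
    have hG : 0 < Real.Gamma (α * k + β) := Real.Gamma_pos_of_pos (by positivity)
    have hp := poch_pos hγ k
    have hy' : |y| ≤ |t| + 1 := by simpa using (mem_ball_zero_iff.1 hy).le
    simp only [g', norm_div, norm_mul, norm_pow, Real.norm_eq_abs, abs_of_pos hp, abs_of_pos hG,
      Nat.abs_cast]
    gcongr
  have hd := hasDerivAt_tsum_of_isPreconnected (y₀ := 0) (y := t) hsum Metric.isOpen_ball
    (convex_ball (0 : ℝ) (|t| + 1)).isPreconnected
    (fun k y _ => ((hasDerivAt_pow k y).const_mul (poch γ k)).div_const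
      (k.factorial * Real.Gamma (α * k + β)))
    hbound (Metric.mem_ball_self hR)
    (summable_of_ne_finset_zero (s := {0}) fun k hk => by
      simp [zero_pow (Finset.notMem_singleton.1 hk)])
    (by simp)
  have ht : Summable fun k => g' k t :=
    Summable.of_norm_bounded hsum fun k => hbound k t (by simp)
  refine HasDerivAt.congr_deriv (f' := ∑' k, g' k t) hd ?_
  rw [ht.tsum_eq_zero_add, prabhakar, ← tsum_mul_left]
  simp only [hg']
  simp [g']

/-- The derivative of the Prabhakar function: `(d/dt) E_{α,β}^γ(t) = γ E_{α,α+β}^{γ+1}(t)`. -/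
theorem prabhakar_deriv (α β γ : ℝ) (hα : 0 < α) (hβ : 0 < β) (hγ : 0 < γ) (t : ℝ) :
    deriv (fun x => prabhakar α β γ x) t = γ * prabhakar α (α + β) (γ + 1) t :=
  (hasDerivAt_prabhakar hα hβ hγ t).deriv
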